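/- arXiv:2303.14437 — 4 statements merged into one kernel-verified Lean document; each statement's English description precedes it below -/
import Mathlib

section
/- Let x, γ solve the full constrained linear system M x = Aᵀ γ and h + A x = 0, and let x̃, γ̃ solve the reduced system obtained by deleting the k-th constraint, i.e. M x̃ = Σ_{i≠k} γ̃_i A_iᵀ and h_i + (A x̃)_i = 0 for all i ≠ k. Then the Lagrange multiplier of the removed constraint satisfies γ_k · (h_k + (A x̃)_k) ≤ 0. -/
open Matrix Finset

/-- Entry and exit of constraints: deleting the k-th constraint from the
full constrained linear system, the product of the removed constraint's
Lagrange multiplier with its residual at the reduced solution is ≤ 0. -/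
theorem entry_exit_of_constraints {n m : ℕ}
    (M : Matrix (Fin n) (Fin n) ℝ) (hM : M.PosDef)
    (A : Matrix (Fin m) (Fin n) ℝ) (h : Fin m → ℝ) (k : Fin m)
    (x xt : Fin n → ℝ) (γ γt : Fin m → ℝ)
    (hfull1 : M.mulVec x = A.transpose.mulVec γ)
    (hfull2 : h + A.mulVec x = 0)
    (hred1 : M.mulVec xt = ∑ i ∈ Finset.univ.erase k, γt i • A i)
    (hred2 : ∀ i, i ≠ k → h i + A.mulVec xt i = 0) :
    γ k * (h k + A.mulVec xt k) ≤ 0 := by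
  have hres (i : Fin m) : A i ⬝ᵥ (xt - x) = h i + A.mulVec xt i := by
    have hi : h i + A i ⬝ᵥ x = 0 := congrFun hfull2 i
    change _ = h i + A i ⬝ᵥ xt
    rw [dotProduct_sub]
    linarith
  have hpos : 0 ≤ (xt - x) ⬝ᵥ M.mulVec (xt - x) := by
    simpa using hM.posSemidef.dotProduct_mulVec_nonneg (xt - x)
  have hred : (∑ i ∈ Finset.univ.erase k, γt i • A i) ⬝ᵥ (xt - x) = 0 := by
    rw [sum_dotProduct]
    refine Finset.sum_eq_zero fun i hi => ?_
    rw [smul_dotProduct, hres, hred2 i (Finset.ne_of_mem_erase hi), smul_zero]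
  have hfull : A.transpose.mulVec γ ⬝ᵥ (xt - x) = γ k * (h k + A.mulVec xt k) := by
    rw [mulVec_transpose, ← dotProduct_mulVec, dotProduct, Finset.sum_eq_single k]
    · rw [← hres]
      rfl
    · intro i _ hi
      change γ i * (A i ⬝ᵥ (xt - x)) = 0
      rw [hres, hred2 i hi, mul_zero]
    · simp
  rw [dotProduct_comm, mulVec_sub, sub_dotProduct, hred1, hfull1, hred, hfull] at hpos
  linarith
end

section
/- Let x, γ solve the full constrained linear system M x = Aᵀ γ and h + A x = 0, and let x̃, γ̃ solve the reduced system obtained by deleting the k-th constraint, i.e. M x̃ = Σ_{i≠k} γ̃_i A_iᵀ and h_i + (A x̃)_i = 0 for all i ≠ k. If the Lagrange multiplier of the k-th constraint in the full system is negative, γ_k < 0, then after removal the k-th constraint becomes feasible: h_k + (A x̃)_k ≥ 0. -/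
open Matrix Finset

/-- If `M` is positive semidefinite, `M d = Aᵀ δ`, and `A d` vanishes off the index `k`, then
`(A d)_k` and `δ_k` have nonnegative product. -/
theorem Matrix.PosSemidef.mulVec_apply_mul_nonneg {ι κ : Type*} [Fintype ι] [Fintype κ]
    {M : Matrix ι ι ℝ} (hM : M.PosSemidef) {A : Matrix κ ι ℝ} {d : ι → ℝ} {δ : κ → ℝ} {k : κ}
    (hd : M *ᵥ d = Aᵀ *ᵥ δ) (hA : ∀ i, i ≠ k → (A *ᵥ d) i = 0) :
    0 ≤ (A *ᵥ d) k * δ k := by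
  have hnonneg : 0 ≤ d ⬝ᵥ M *ᵥ d := by simpa using hM.dotProduct_mulVec_nonneg d
  rw [hd, dotProduct_mulVec, vecMul_transpose, dotProduct,
    Finset.sum_eq_single k (fun i _ hi => by rw [hA i hi, zero_mul]) (by simp)] at hnonneg
  exact hnonneg

/-- Corollary (first assertion): a constraint of the working set with a
negative Lagrange multiplier becomes feasible once removed. -/
theorem removed_constraint_becomes_feasible {n m : ℕ}
    (M : Matrix (Fin n) (Fin n) ℝ) (hM : M.PosDef)
    (A : Matrix (Fin m) (Fin n) ℝ) (h : Fin m → ℝ) (k : Fin m)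
    (x xt : Fin n → ℝ) (γ γt : Fin m → ℝ)
    (hfull1 : M.mulVec x = A.transpose.mulVec γ)
    (hfull2 : h + A.mulVec x = 0)
    (hred1 : M.mulVec xt = ∑ i ∈ Finset.univ.erase k, γt i • A i)
    (hred2 : ∀ i, i ≠ k → h i + A.mulVec xt i = 0)
    (hneg : γ k < 0) :
    h k + A.mulVec xt k ≥ 0 := by
  have hsum : M *ᵥ xt = Aᵀ *ᵥ Function.update γt k 0 := by
    rw [hred1, mulVec_eq_sum, ← Finset.add_sum_erase _ _ (Finset.mem_univ k)]
    simp only [Function.update_self, MulOpposite.op_zero, zero_smul, zero_add, transpose_transpose]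
    refine Finset.sum_congr rfl fun i hi => ?_
    rw [Function.update_of_ne (Finset.ne_of_mem_erase hi), op_smul_eq_smul]
  have hres : ∀ i, (A *ᵥ (xt - x)) i = h i + (A *ᵥ xt) i := fun i => by
    have hi := congrFun hfull2 i
    simp only [Pi.add_apply, Pi.zero_apply] at hi
    rw [mulVec_sub, Pi.sub_apply]
    linarith
  have hprod := hM.posSemidef.mulVec_apply_mul_nonneg (A := A) (d := xt - x)
    (δ := Function.update γt k 0 - γ) (k := k)
    (by rw [mulVec_sub, mulVec_sub, hsum, hfull1])
    (fun i hi => (hres i).trans (hred2 i hi))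
  rw [hres, Pi.sub_apply, Function.update_self, zero_sub] at hprod
  exact nonneg_of_mul_nonneg_left hprod (neg_pos.mpr hneg)
end

section
/- Let x, γ solve the full constrained linear system M x = Aᵀ γ and h + A x = 0, and let x̃, γ̃ solve the reduced system obtained by deleting the k-th constraint, i.e. M x̃ = Σ_{i≠k} γ̃_i A_iᵀ and h_i + (A x̃)_i = 0 for all i ≠ k. If the removed constraint is infeasible at x̃, i.e. h_k + (A x̃)_k < 0, then its Lagrange multiplier in the full system is nonnegative: γ_k ≥ 0. -/
open Matrix Finset

/-- Corollary (second assertion): if after removal the k-th constraint is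
infeasible, then its Lagrange multiplier in the full system is nonnegative. -/
theorem infeasible_constraint_has_nonneg_multiplier {n m : ℕ}
    (M : Matrix (Fin n) (Fin n) ℝ) (hM : M.PosDef)
    (A : Matrix (Fin m) (Fin n) ℝ) (h : Fin m → ℝ) (k : Fin m)
    (x xt : Fin n → ℝ) (γ γt : Fin m → ℝ)
    (hfull1 : M.mulVec x = A.transpose.mulVec γ)
    (hfull2 : h + A.mulVec x = 0)
    (hred1 : M.mulVec xt = ∑ i ∈ Finset.univ.erase k, γt i • A i)
    (hred2 : ∀ i, i ≠ k → h i + A.mulVec xt i = 0)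
    (hinf : h k + A.mulVec xt k < 0) :
    γ k ≥ 0 := by
  have hM_sub : M *ᵥ (x - xt) = Aᵀ *ᵥ (γ - Function.update γt k 0) := by
    have hred : ∑ i ∈ Finset.univ.erase k, γt i • A i = Aᵀ *ᵥ Function.update γt k 0 := by
      rw [mulVec_transpose, vecMul_eq_sum, ← Finset.add_sum_erase _ _ (Finset.mem_univ k)]
      simp only [Function.update_self, zero_smul, zero_add]
      refine Finset.sum_congr rfl fun i hi => ?_
      rw [Function.update_of_ne (Finset.ne_of_mem_erase hi)]
    rw [mulVec_sub, mulVec_sub, hfull1, hred1, hred]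
  have hA_sub : ∀ i, (A *ᵥ (x - xt)) i = -(h i + (A *ᵥ xt) i) := fun i => by
    have hi := congrFun hfull2 i
    simp only [Pi.add_apply, Pi.zero_apply] at hi
    rw [mulVec_sub, Pi.sub_apply]
    linarith
  have hquad : (x - xt) ⬝ᵥ M *ᵥ (x - xt) = -(h k + (A *ᵥ xt) k) * γ k := by
    rw [hM_sub, dotProduct_mulVec, vecMul_transpose, dotProduct,
      Finset.sum_eq_single k]
    · simp [hA_sub]
    · intro i _ hi
      rw [hA_sub, hred2 i hi, neg_zero, zero_mul]
    · simp
  have hnonneg : 0 ≤ (x - xt) ⬝ᵥ M *ᵥ (x - xt) := by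
    simpa using hM.posSemidef.dotProduct_mulVec_nonneg (x - xt)
  rw [hquad] at hnonneg
  exact nonneg_of_mul_nonneg_right hnonneg (neg_pos.mpr hinf)
end

section
/- Let x, γ solve the full constrained linear system M x = Aᵀ γ and h + A x = 0, and let x̃, γ̃ solve the reduced system obtained by deleting the k-th constraint, i.e. M x̃ = Σ_{i≠k} γ̃_i A_iᵀ and h_i + (A x̃)_i = 0 for all i ≠ k. Then (A (x̃ − x))_i = 0 for every i ≠ k, and consequently the energy identity (x̃ − x)ᵀ M (x̃ − x) = − γ_k · (A (x̃ − x))_k holds; in particular γ_k · (A (x̃ − x))_k ≤ 0. -/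
open Matrix Finset

/-- Second intermediate step of the 'Entry and exit of constraints' proof:
(A(x̃−x))_i = 0 for i ≠ k, the energy identity
(x̃−x)ᵀ M (x̃−x) = −γ_k (A(x̃−x))_k, and consequently γ_k (A(x̃−x))_k ≤ 0. -/
theorem energy_identity {n m : ℕ}
    (M : Matrix (Fin n) (Fin n) ℝ) (hM : M.PosDef)
    (A : Matrix (Fin m) (Fin n) ℝ) (h : Fin m → ℝ) (k : Fin m)
    (x xt : Fin n → ℝ) (γ γt : Fin m → ℝ)
    (hfull1 : M.mulVec x = A.transpose.mulVec γ)
    (hfull2 : h + A.mulVec x = 0)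
    (hred1 : M.mulVec xt = ∑ i ∈ Finset.univ.erase k, γt i • A i)
    (hred2 : ∀ i, i ≠ k → h i + A.mulVec xt i = 0) :
    (∀ i, i ≠ k → A.mulVec (xt - x) i = 0) ∧
    (xt - x) ⬝ᵥ M.mulVec (xt - x) = -(γ k * A.mulVec (xt - x) k) ∧
    γ k * A.mulVec (xt - x) k ≤ 0 := by
  have hzero : ∀ i, i ≠ k → A.mulVec (xt - x) i = 0 := by
    intro i hi
    have hfull := congrFun hfull2 i
    have hred := hred2 i hi
    simp only [Pi.add_apply, Pi.zero_apply] at hfull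
    rw [mulVec_sub, Pi.sub_apply]
    linarith
  have hfull : (xt - x) ⬝ᵥ M.mulVec x = γ k * A.mulVec (xt - x) k := by
    rw [hfull1, dotProduct_mulVec, vecMul_transpose, dotProduct,
      Finset.sum_eq_single k (fun i _ hi => by rw [hzero i hi, zero_mul]) (by simp), mul_comm]
  have hred : (xt - x) ⬝ᵥ M.mulVec xt = 0 := by
    rw [hred1, dotProduct_sum]
    refine Finset.sum_eq_zero fun i hi => ?_
    have hrow : (xt - x) ⬝ᵥ A i = 0 :=
      (dotProduct_comm _ _).trans (hzero i (Finset.ne_of_mem_erase hi))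
    rw [dotProduct_smul, hrow, smul_zero]
  have henergy : (xt - x) ⬝ᵥ M.mulVec (xt - x) = -(γ k * A.mulVec (xt - x) k) := by
    rw [mulVec_sub, dotProduct_sub, hred, hfull, zero_sub]
  have hnonneg : 0 ≤ (xt - x) ⬝ᵥ M.mulVec (xt - x) := by
    simpa using hM.posSemidef.dotProduct_mulVec_nonneg (xt - x)
  exact ⟨hzero, henergy, by linarith⟩
end
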